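/- Let α ≥ 1 and let f ∈ G_α(ℝ^d₊). Then there exist constants C, A > 0 such that |D^p ℱ_D(f)(w)| ≤ C A^{|p|} p^{αp} for every p ∈ ℕ₀^d and every w ∈ D with Re w_l ≤ 0 for l = 1,…,d. -/

import Mathlib

open MeasureTheory Filter Finset

noncomputable section

def Rpos (d : ℕ) : Set (Fin d → ℝ) := {x | ∀ i, 0 < x i}

def pd {d : ℕ} (i : Fin d) (f : (Fin d → ℝ) → ℂ) : (Fin d → ℝ) → ℂ :=
  fun x => fderiv ℝ f x (Pi.single i 1)

def mderiv {d : ℕ} (p : Fin d → ℕ) (f : (Fin d → ℝ) → ℂ) : (Fin d → ℝ) → ℂ :=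
  ((List.ofFn fun i : Fin d => (fun g => (pd i)^[p i] g)).foldr (· ∘ ·) id) f

/-- The space `S(ℝ^d₊)`. -/
def IsSPlus {d : ℕ} (f : (Fin d → ℝ) → ℂ) : Prop :=
  ContDiffOn ℝ (⊤ : ℕ∞) f (Rpos d) ∧
  (∀ p : Fin d → ℕ, ∃ g : (Fin d → ℝ) → ℂ,
    ContinuousOn g {x | ∀ i, 0 ≤ x i} ∧ ∀ x ∈ Rpos d, g x = mderiv p f x) ∧
  (∀ k p : Fin d → ℕ, ∃ C : ℝ, ∀ x ∈ Rpos d,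
    (∏ i, x i ^ k i) * ‖mderiv p f x‖ ≤ C)

/-- The space `G_α(ℝ^d₊)`. -/
def IsGlow {d : ℕ} (α : ℝ) (f : (Fin d → ℝ) → ℂ) : Prop :=
  IsSPlus f ∧ ∃ A > (0:ℝ), ∀ p : Fin d → ℕ, ∃ C : ℝ, ∀ k : Fin d → ℕ,
    Real.sqrt (∫ t in Rpos d, ((∏ i, t i ^ (((p i : ℝ) + (k i : ℝ))/2)) * ‖mderiv p f t‖)^2) ≤
      C * A ^ (∑ i, k i) * (∏ i, ((k i : ℝ)) ^ ((α/2) * (k i : ℝ)))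

/-- The open unit polydisc. -/
def Dpoly (d : ℕ) : Set (Fin d → ℂ) := {w | ∀ l, ‖w l‖ < 1}

/-- The transform `ℱ_D`. -/
def FD {d : ℕ} (f : (Fin d → ℝ) → ℂ) : (Fin d → ℂ) → ℂ :=
  fun w => ∫ t in Rpos d, f t * ∏ l, Complex.exp (-(1/2) * ((1 + w l)/(1 - w l)) * (t l : ℂ))

/-- Complex partial derivative in the `i`-th coordinate direction. -/
def pdC {d : ℕ} (i : Fin d) (F : (Fin d → ℂ) → ℂ) : (Fin d → ℂ) → ℂ :=
  fun w => fderiv ℂ F w (Pi.single i 1)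

/-- Multi-index complex derivative `D^p F`. -/
def mderivC {d : ℕ} (p : Fin d → ℕ) (F : (Fin d → ℂ) → ℂ) : (Fin d → ℂ) → ℂ :=
  ((List.ofFn fun i : Fin d => (fun G => (pdC i)^[p i] G)).foldr (· ∘ ·) id) F


/-- Coefficients in the closed form of the derivatives of the kernel of `ℱ_D`. -/
def kernelCoeff : ℕ → ℕ → ℝ
  | 0, 0 => 1
  | 0, _ + 1 => 0
  | n + 1, 0 => n * kernelCoeff n 0
  | n + 1, j + 1 => (n + j + 1) * kernelCoeff n (j + 1) - kernelCoeff n j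

/-- The `n`-th complex derivative of `w ↦ exp (-(1/2) * ((1 + w)/(1 - w)) * t)`. -/
def kernelDeriv (n : ℕ) (t : ℝ) (w : ℂ) : ℂ :=
  (∑ j ∈ range (n + 1), (kernelCoeff n j : ℂ) * (t : ℂ) ^ j * ((1 - w)⁻¹) ^ (n + j)) *
    Complex.exp (-(1/2) * ((1 + w)/(1 - w)) * (t : ℂ))

theorem kernelCoeff_eq_zero : ∀ n j : ℕ, n < j → kernelCoeff n j = 0
  | 0, 0, h => by omega
  | 0, j + 1, _ => by simp [kernelCoeff]
  | n + 1, 0, h => by omega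
  | n + 1, j + 1, h => by
    simp [kernelCoeff, kernelCoeff_eq_zero n (j + 1) (by omega),
      kernelCoeff_eq_zero n j (by omega)]

theorem abs_kernelCoeff_mul_factorial_le :
    ∀ n j : ℕ, |kernelCoeff n j| * (j.factorial : ℝ) ≤ 3 ^ n * (n.factorial : ℝ)
  | 0, 0 => by simp [kernelCoeff]
  | 0, j + 1 => by simp [kernelCoeff]
  | n + 1, 0 => by
    have h := abs_kernelCoeff_mul_factorial_le n 0
    have hp : (0:ℝ) ≤ 3 ^ n * (n.factorial : ℝ) := by positivity
    simp only [Nat.factorial_zero, Nat.cast_one, mul_one] at h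
    simp only [kernelCoeff, abs_mul, Nat.abs_cast, Nat.factorial_zero, Nat.cast_one, mul_one,
      Nat.factorial_succ, Nat.cast_mul, Nat.cast_add, pow_succ]
    have hn : (0:ℝ) ≤ n := by positivity
    nlinarith [mul_le_mul_of_nonneg_left h hn, mul_nonneg hn hp]
  | n + 1, j + 1 => by
    have h1 := abs_kernelCoeff_mul_factorial_le n (j + 1)
    have h2 := abs_kernelCoeff_mul_factorial_le n j
    have hp : (0:ℝ) ≤ 3 ^ n * (n.factorial : ℝ) := by positivity
    by_cases hj : n + 1 < j + 1
    · rw [kernelCoeff_eq_zero _ _ hj, abs_zero, zero_mul]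
      positivity
    have hjn : (j : ℝ) ≤ n := by exact_mod_cast (by omega : j ≤ n)
    have hj0 : (0:ℝ) ≤ j := by positivity
    have e : |kernelCoeff (n + 1) (j + 1)| ≤
        (n + j + 1) * |kernelCoeff n (j + 1)| + |kernelCoeff n j| := by
      rw [kernelCoeff]
      refine (abs_sub _ _).trans_eq ?_
      rw [abs_mul, abs_of_nonneg (by positivity : (0:ℝ) ≤ n + j + 1)]
    have hf : ((j + 1).factorial : ℝ) = (j + 1) * j.factorial := by
      push_cast [Nat.factorial_succ]; ring
    calc |kernelCoeff (n + 1) (j + 1)| * ((j + 1).factorial : ℝ)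
        ≤ ((n + j + 1) * |kernelCoeff n (j + 1)| + |kernelCoeff n j|) * (j + 1).factorial := by
          gcongr
      _ = (n + j + 1) * (|kernelCoeff n (j + 1)| * (j + 1).factorial) +
          (j + 1) * (|kernelCoeff n j| * j.factorial) := by rw [hf]; ring
      _ ≤ (n + j + 1) * (3 ^ n * (n.factorial : ℝ)) + (j + 1) * (3 ^ n * (n.factorial : ℝ)) := by
          gcongr
      _ ≤ 3 ^ (n + 1) * ((n + 1).factorial : ℝ) := by
          push_cast [Nat.factorial_succ, pow_succ]
          nlinarith

theorem kernelDeriv_zero (t : ℝ) (w : ℂ) :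
    kernelDeriv 0 t w = Complex.exp (-(1/2) * ((1 + w)/(1 - w)) * (t : ℂ)) := by
  simp [kernelDeriv, kernelCoeff]

theorem hasDerivAt_kernelDeriv (n : ℕ) (t : ℝ) {w : ℂ} (hw : 1 - w ≠ 0) :
    HasDerivAt (kernelDeriv n t) (kernelDeriv (n + 1) t w) w := by
  have h1 : HasDerivAt (fun w : ℂ => 1 - w) (-1) w := by
    simpa using (hasDerivAt_id w).const_sub 1
  have hu : HasDerivAt (fun w : ℂ => (1 - w)⁻¹) (((1 - w)⁻¹) ^ 2) w := by
    refine (h1.fun_inv hw).congr_deriv ?_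
    simp
  have hφ : HasDerivAt (fun w : ℂ => -(1/2) * ((1 + w)/(1 - w)) * (t : ℂ))
      (-(t : ℂ) * ((1 - w)⁻¹) ^ 2) w := by
    have h2 : HasDerivAt (fun w : ℂ => 1 + w) 1 w := by
      simpa using (hasDerivAt_id w).const_add 1
    refine (((h2.fun_div h1 hw).const_mul (-(1/2) : ℂ)).mul_const (t : ℂ)).congr_deriv ?_
    field_simp
    ring
  have hs : HasDerivAt
      (fun w : ℂ => ∑ j ∈ range (n + 1),
        (kernelCoeff n j : ℂ) * (t : ℂ) ^ j * ((1 - w)⁻¹) ^ (n + j))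
      (∑ j ∈ range (n + 1), (kernelCoeff n j : ℂ) * (t : ℂ) ^ j *
        ((n + j : ℕ) * ((1 - w)⁻¹) ^ (n + j + 1))) w := by
    refine HasDerivAt.fun_sum fun j _ => ?_
    refine ((hu.fun_pow (n + j)).const_mul _).congr_deriv ?_
    rcases Nat.eq_zero_or_pos (n + j) with h | h
    · simp [h]
    · obtain ⟨m, hm⟩ : ∃ m, n + j = m + 1 := ⟨n + j - 1, by omega⟩
      rw [hm]
      simp only [Nat.add_sub_cancel]
      ring
  refine (hs.fun_mul hφ.cexp).congr_deriv ?_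
  rw [kernelDeriv]
  generalize Complex.exp (-(1/2) * ((1 + w)/(1 - w)) * (t : ℂ)) = E
  generalize (1 - w)⁻¹ = u
  have key : ∑ j ∈ range (n + 1 + 1),
        (kernelCoeff (n + 1) j : ℂ) * (t : ℂ) ^ j * u ^ (n + 1 + j) =
      (∑ j ∈ range (n + 1 + 1), (kernelCoeff n j : ℂ) * (t : ℂ) ^ j *
        ((n + j : ℕ) * u ^ (n + j + 1))) -
      ∑ j ∈ range (n + 1), (kernelCoeff n j : ℂ) * (t : ℂ) ^ (j + 1) * u ^ (n + j + 2) := by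
    rw [sum_range_succ', sum_range_succ' _ (n + 1), add_sub_right_comm, ← sum_sub_distrib]
    congr 1
    · refine sum_congr rfl fun j _ => ?_
      simp only [kernelCoeff]
      push_cast
      ring
    · simp only [kernelCoeff]
      push_cast
      ring
  rw [key, sum_range_succ _ (n + 1), kernelCoeff_eq_zero n (n + 1) (by omega)]
  have e : ∑ j ∈ range (n + 1), (kernelCoeff n j : ℂ) * (t : ℂ) ^ (j + 1) * u ^ (n + j + 2) =
      (∑ j ∈ range (n + 1), (kernelCoeff n j : ℂ) * (t : ℂ) ^ j * u ^ (n + j)) *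
        ((t : ℂ) * u ^ 2) := by
    rw [sum_mul]
    exact sum_congr rfl fun j _ => by ring
  rw [e]
  push_cast
  ring

theorem continuous_kernelDeriv (n : ℕ) (w : ℂ) : Continuous fun t : ℝ => kernelDeriv n t w := by
  unfold kernelDeriv
  fun_prop

theorem norm_kernelDeriv_le (n : ℕ) {t : ℝ} (ht : 0 ≤ t) {w : ℂ} (hw : ‖w‖ < 1) {R : ℝ}
    (hR : 1 ≤ R) (hwR : ‖(1 - w)⁻¹‖ ≤ R) :
    ‖kernelDeriv n t w‖ ≤
      ∑ j ∈ range (n + 1), (R ^ (2 * n) * 3 ^ n * (n.factorial / j.factorial : ℝ)) * t ^ j := by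
  have hexp : ‖Complex.exp (-(1/2) * ((1 + w)/(1 - w)) * (t : ℂ))‖ ≤ 1 := by
    rw [Complex.norm_exp, Real.exp_le_one_iff]
    have hre : 0 ≤ ((1 + w)/(1 - w)).re := by
      rw [Complex.div_re, ← add_div]
      refine div_nonneg ?_ (Complex.normSq_nonneg _)
      have h := Complex.sq_norm w
      rw [Complex.normSq_apply] at h
      have : ‖w‖ ^ 2 < 1 := by nlinarith [norm_nonneg w]
      simp
      nlinarith
    have : (-(1/2) * ((1 + w)/(1 - w)) * (t : ℂ)).re = -(1/2) * ((1 + w)/(1 - w)).re * t := by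
      rw [Complex.re_mul_ofReal]
      congr 1
      have : (-(1/2) : ℂ) = ((-(1/2) : ℝ) : ℂ) := by push_cast; ring
      rw [this, Complex.re_ofReal_mul]
    rw [this]
    nlinarith [mul_nonneg hre ht]
  rw [kernelDeriv, norm_mul]
  refine (mul_le_of_le_one_right (norm_nonneg _) hexp).trans ?_
  refine (norm_sum_le _ _).trans (sum_le_sum fun j hj => ?_)
  have hjn : j ≤ n := by simpa [Nat.lt_succ_iff] using hj
  rw [norm_mul, norm_mul, norm_pow, norm_pow, Complex.norm_real, Complex.norm_real,
    Real.norm_of_nonneg ht, Real.norm_eq_abs]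
  have h1 : |kernelCoeff n j| ≤ 3 ^ n * (n.factorial / j.factorial : ℝ) := by
    rw [← mul_div_assoc, le_div_iff₀ (by positivity)]
    exact abs_kernelCoeff_mul_factorial_le n j
  have h2 : ‖(1 - w)⁻¹‖ ^ (n + j) ≤ R ^ (2 * n) :=
    (pow_le_pow_left₀ (norm_nonneg _) hwR _).trans (pow_le_pow_right₀ hR (by omega))
  calc |kernelCoeff n j| * t ^ j * ‖(1 - w)⁻¹‖ ^ (n + j)
      ≤ (3 ^ n * (n.factorial / j.factorial : ℝ)) * t ^ j * R ^ (2 * n) := by gcongr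
    _ = _ := by ring

theorem isOpen_Rpos (d : ℕ) : IsOpen (Rpos d) := by
  have : Rpos d = Set.pi Set.univ fun _ => Set.Ioi (0:ℝ) := by
    ext x
    simp [Rpos]
  rw [this]
  exact isOpen_set_pi Set.finite_univ fun _ _ => isOpen_Ioi

theorem ae_mem_Rpos (d : ℕ) :
    ∀ᵐ t ∂((volume : Measure (Fin d → ℝ)).restrict (Rpos d)), t ∈ Rpos d :=
  ae_restrict_mem (isOpen_Rpos d).measurableSet

theorem foldr_comp_apply {ι β : Type*} (l : List ι) (φ : ι → β → β) (P : ι → β → β)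
    (h : ∀ i x, φ i x = P i x) (x : β) :
    ((l.map φ).foldr (· ∘ ·) id) x = l.foldr P x := by
  induction l with
  | nil => rfl
  | cons a l ih => simp [ih, h]

theorem mderiv_zero {d : ℕ} (f : (Fin d → ℝ) → ℂ) : mderiv 0 f = f := by
  unfold mderiv
  rw [List.ofFn_eq_map, foldr_comp_apply _ _ (fun _ g => g) (by simp)]
  generalize List.finRange d = l
  induction l with
  | nil => rfl
  | cons a l ih => simp

/-- `∏ (1 + t_l ^ 2)` is a sum of even monomials. -/
theorem prod_one_add_sq {d : ℕ} (t : Fin d → ℝ) :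
    ∏ l, (1 + t l ^ 2) = ∑ s : Finset (Fin d), ∏ l, t l ^ (if l ∈ s then 2 else 0) := by
  rw [prod_one_add, powerset_univ]
  refine sum_congr rfl fun s _ => ?_
  rw [← Fintype.prod_ite_mem]
  refine prod_congr rfl fun l _ => ?_
  split_ifs <;> simp

theorem integrable_prod_inv_one_add_sq (d : ℕ) :
    Integrable (fun t : Fin d → ℝ => (∏ l, (1 + t l ^ 2))⁻¹) (volume.restrict (Rpos d)) := by
  have h : Integrable (fun t : Fin d → ℝ => ∏ l, (1 + t l ^ 2)⁻¹)
      (Measure.pi fun _ => volume) :=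
    Integrable.fintype_prod (f := fun _ x => (1 + x ^ 2)⁻¹) fun _ => integrable_inv_one_add_sq
  rw [← volume_pi] at h
  simp_rw [prod_inv_distrib] at h
  exact h.restrict

theorem aestronglyMeasurable_of_isSPlus {d : ℕ} {f : (Fin d → ℝ) → ℂ} (hf : IsSPlus f) :
    AEStronglyMeasurable f (volume.restrict (Rpos d)) :=
  hf.1.continuousOn.aestronglyMeasurable (isOpen_Rpos d).measurableSet

theorem prod_pow_nonneg {d : ℕ} {t : Fin d → ℝ} (ht : t ∈ Rpos d) (k : Fin d → ℕ) :
    0 ≤ ∏ l, t l ^ k l := prod_nonneg fun l _ => pow_nonneg (ht l).le _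

theorem exists_monomial_bound {d : ℕ} {f : (Fin d → ℝ) → ℂ} (hf : IsSPlus f) (k : Fin d → ℕ) :
    ∃ C : ℝ, ∀ t ∈ Rpos d, (∏ l, t l ^ k l) * ‖f t‖ ≤ C := by
  simpa only [mderiv_zero] using hf.2.2 k 0

theorem integrable_monomial_mul_norm {d : ℕ} {f : (Fin d → ℝ) → ℂ} (hf : IsSPlus f)
    (k : Fin d → ℕ) :
    Integrable (fun t => (∏ l, t l ^ k l) * ‖f t‖) (volume.restrict (Rpos d)) := by
  choose C hC using exists_monomial_bound hf
  refine Integrable.mono'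
    ((integrable_prod_inv_one_add_sq d).const_mul
      (∑ s : Finset (Fin d), C fun l => k l + if l ∈ s then 2 else 0)) ?_ ?_
  · exact (Continuous.aestronglyMeasurable (by fun_prop)).mul
      (aestronglyMeasurable_of_isSPlus hf).norm
  · filter_upwards [ae_mem_Rpos d] with t ht
    have hP : 0 < ∏ l, (1 + t l ^ 2) := prod_pos fun l _ => by positivity
    rw [Real.norm_of_nonneg (mul_nonneg (prod_pow_nonneg ht k) (norm_nonneg _)),
      ← div_eq_mul_inv, le_div_iff₀ hP, prod_one_add_sq, mul_sum]
    refine sum_le_sum fun s _ => le_trans (le_of_eq ?_) (hC _ t ht)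
    simp only [pow_add, prod_mul_distrib]
    ring

theorem integrable_monomial_mul_norm_sq {d : ℕ} {f : (Fin d → ℝ) → ℂ} (hf : IsSPlus f)
    (k : Fin d → ℕ) :
    Integrable (fun t => (∏ l, t l ^ k l) * ‖f t‖ ^ 2) (volume.restrict (Rpos d)) := by
  obtain ⟨C, hC⟩ := exists_monomial_bound hf 0
  refine ((integrable_monomial_mul_norm hf k).bdd_mul (c := C)
    (aestronglyMeasurable_of_isSPlus hf).norm ?_).congr ?_
  · filter_upwards [ae_mem_Rpos d] with t ht
    simpa using hC t ht
  · exact Eventually.of_forall fun t => by ring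

theorem exists_moment_sq_bound {d : ℕ} {α : ℝ} {f : (Fin d → ℝ) → ℂ} (hf : IsGlow α f) :
    ∃ C ≥ (0:ℝ), ∃ A ≥ (1:ℝ), ∀ k : Fin d → ℕ,
      ∫ t in Rpos d, (∏ l, t l ^ k l) * ‖f t‖ ^ 2 ≤
        (C * ∏ l, (A ^ k l * (k l : ℝ) ^ ((α/2) * (k l : ℝ)))) ^ 2 := by
  obtain ⟨hS, A, hA, h⟩ := hf
  obtain ⟨C, hC⟩ := h 0
  refine ⟨max C 0, le_max_right _ _, max A 1, le_max_right _ _, fun k => ?_⟩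
  have h1 := hC k
  have h2 : ∫ t in Rpos d, ((∏ i, t i ^ ((((0 : Fin d → ℕ) i : ℝ) + (k i : ℝ))/2)) *
      ‖mderiv 0 f t‖)^2 = ∫ t in Rpos d, (∏ l, t l ^ k l) * ‖f t‖ ^ 2 := by
    refine setIntegral_congr_fun (isOpen_Rpos d).measurableSet fun t ht => ?_
    simp only [mderiv_zero, mul_pow, ← prod_pow]
    congr 1
    refine prod_congr rfl fun l _ => ?_
    rw [← Real.rpow_natCast _ 2, ← Real.rpow_mul (ht l).le, ← Real.rpow_natCast]
    congr 1
    simp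
  rw [h2] at h1
  refine (Real.sqrt_le_left ?_).1 (h1.trans ?_)
  · have : 0 ≤ ∏ l, ((max A 1) ^ k l * (k l : ℝ) ^ ((α/2) * (k l : ℝ))) :=
      prod_nonneg fun l _ => by positivity
    positivity
  · rw [prod_mul_distrib, prod_pow_eq_pow_sum, mul_assoc]
    have : 0 ≤ ∏ i, ((k i : ℝ)) ^ ((α/2) * (k i : ℝ)) := prod_nonneg fun l _ => by positivity
    gcongr
    · exact le_max_left _ _
    · exact le_max_left _ _

theorem natCast_add_two_pow_le (n : ℕ) :
    (2 * n + 2 : ℝ) ^ (n + 1) ≤ 4 * 8 ^ n * (n : ℝ) ^ n := by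
  rcases Nat.eq_zero_or_pos n with rfl | hn
  · norm_num
  have h1 : (1:ℝ) ≤ n := by exact_mod_cast hn
  have h2 : (n : ℝ) ≤ 2 ^ n := by exact_mod_cast (Nat.lt_two_pow_self (n := n)).le
  calc (2 * n + 2 : ℝ) ^ (n + 1) ≤ (4 * n) ^ (n + 1) := by gcongr; linarith
    _ = 4 * 4 ^ n * (n : ℝ) ^ n * n := by rw [mul_pow, pow_succ, pow_succ]; ring
    _ ≤ 4 * 4 ^ n * (n : ℝ) ^ n * 2 ^ n := by gcongr
    _ = 4 * 8 ^ n * (n : ℝ) ^ n := by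
      rw [show (8:ℝ) = 4 * 2 by norm_num, mul_pow]; ring

theorem rpow_half_mul_le {α : ℝ} (hα : 1 ≤ α) {A : ℝ} (hA : 1 ≤ A) (n k : ℕ)
    (hk : k = 2 * n ∨ k = 2 * n + 2) :
    A ^ k * (k : ℝ) ^ ((α/2) * (k : ℝ)) ≤
      (A ^ 2 * 4 ^ α) * ((A ^ 2 * 8 ^ α) ^ n * (n : ℝ) ^ (α * (n : ℝ))) := by
  have hkn : k ≤ 2 * n + 2 := by omega
  have hkn' : (k : ℝ) ≤ 2 * n + 2 := by exact_mod_cast hkn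
  have h1 : (k : ℝ) ^ ((α/2) * (k : ℝ)) ≤ (2 * n + 2 : ℝ) ^ (α * (n + 1 : ℝ)) := by
    calc (k : ℝ) ^ ((α/2) * (k : ℝ)) ≤ (2 * n + 2 : ℝ) ^ ((α/2) * (k : ℝ)) := by
          refine Real.rpow_le_rpow (by positivity) hkn' (by positivity)
      _ ≤ (2 * n + 2 : ℝ) ^ (α * (n + 1 : ℝ)) := by
          refine Real.rpow_le_rpow_of_exponent_le (by linarith [n.cast_nonneg (α := ℝ)]) ?_
          nlinarith
  have h2 : (2 * n + 2 : ℝ) ^ (α * (n + 1 : ℝ)) ≤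
      4 ^ α * ((8 ^ α) ^ n * (n : ℝ) ^ (α * (n : ℝ))) := by
    have e : (2 * n + 2 : ℝ) ^ (α * (n + 1 : ℝ)) = ((2 * n + 2 : ℝ) ^ (n + 1)) ^ α := by
      rw [← Real.rpow_natCast, ← Real.rpow_mul (by positivity)]
      push_cast
      ring_nf
    have e2 : (4 : ℝ) ^ α * ((8 ^ α) ^ n * (n : ℝ) ^ (α * (n : ℝ))) =
        (4 * 8 ^ n * (n : ℝ) ^ n) ^ α := by
      rw [Real.mul_rpow (by positivity) (by positivity),
        Real.mul_rpow (by positivity) (by positivity), mul_assoc]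
      congr 2
      · rw [← Real.rpow_natCast, ← Real.rpow_natCast, ← Real.rpow_mul (by positivity),
          ← Real.rpow_mul (by positivity), mul_comm]
      · rw [← Real.rpow_natCast, ← Real.rpow_mul (by positivity), mul_comm]
    rw [e, e2]
    exact Real.rpow_le_rpow (by positivity) (natCast_add_two_pow_le n) (by positivity)
  calc A ^ k * (k : ℝ) ^ ((α/2) * (k : ℝ))
      ≤ A ^ (2 * n + 2) * (4 ^ α * ((8 ^ α) ^ n * (n : ℝ) ^ (α * (n : ℝ)))) := by
        gcongr
        exact h1.trans h2
    _ = _ := by rw [mul_pow, pow_add, pow_mul]; ring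

theorem exists_moment_bound {d : ℕ} {α : ℝ} (hα : 1 ≤ α) {f : (Fin d → ℝ) → ℂ}
    (hf : IsGlow α f) :
    ∃ C > (0:ℝ), ∃ B ≥ (1:ℝ), ∀ k : Fin d → ℕ,
      ∫ t in Rpos d, (∏ l, t l ^ k l) * ‖f t‖ ≤
        C * ∏ l, (B ^ k l * (k l : ℝ) ^ (α * (k l : ℝ))) := by
  obtain ⟨C, hC, A, hA, h⟩ := exists_moment_sq_bound hf
  have hS := hf.1
  set J := ∫ t in Rpos d, (∏ l, (1 + t l ^ 2))⁻¹ with hJ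
  have hJ0 : 0 ≤ J := setIntegral_nonneg (isOpen_Rpos d).measurableSet fun t _ =>
    inv_nonneg.2 (prod_nonneg fun l _ => by positivity)
  set E : ℝ := A ^ 2 * 4 ^ α with hE
  have hE0 : 0 < E := by positivity
  set N : ℝ := (Fintype.card (Finset (Fin d)) : ℝ)
  refine ⟨(N * C ^ 2 * E ^ d + J * E ^ d + 1), by positivity, A ^ 2 * 8 ^ α, ?_, fun k => ?_⟩
  · have := Real.one_le_rpow (by norm_num : (1:ℝ) ≤ 8) (by linarith : 0 ≤ α)
    exact one_le_mul_of_one_le_of_one_le (one_le_pow₀ hA) this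
  set m : ℝ := ∏ l, ((A ^ 2 * 8 ^ α) ^ k l * (k l : ℝ) ^ (α * (k l : ℝ))) with hm
  have hm0 : 0 < m := prod_pos fun l _ => by
    rcases Nat.eq_zero_or_pos (k l) with h0 | h0
    · simp [h0]
    · have : (0:ℝ) < k l := by exact_mod_cast h0
      positivity
  set M : ℝ := E ^ d * m with hM
  have hM0 : 0 < M := by positivity
  have hs : ∀ s : Finset (Fin d),
      ∫ t in Rpos d, (∏ l, t l ^ (2 * k l + if l ∈ s then 2 else 0)) * ‖f t‖ ^ 2 ≤
        (C * M) ^ 2 := fun s => by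
    refine (h _).trans ?_
    have h0 : 0 ≤ ∏ l, (A ^ (2 * k l + if l ∈ s then 2 else 0) *
        ((2 * k l + if l ∈ s then 2 else 0 : ℕ) : ℝ) ^
          ((α/2) * ((2 * k l + if l ∈ s then 2 else 0 : ℕ) : ℝ))) :=
      prod_nonneg fun l _ => by positivity
    have h1 : M = ∏ l : Fin d, (E * ((A ^ 2 * 8 ^ α) ^ k l * (k l : ℝ) ^ (α * (k l : ℝ)))) := by
      rw [prod_mul_distrib, prod_const, card_univ, Fintype.card_fin]
    rw [h1]
    refine pow_le_pow_left₀ (mul_nonneg hC h0) (mul_le_mul_of_nonneg_left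
      (prod_le_prod (fun l _ => by positivity) fun l _ => ?_) hC) 2
    refine rpow_half_mul_le hα hA (k l) _ ?_
    split_ifs <;> simp
  have hle : ∫ t in Rpos d, (∏ l, t l ^ k l) * ‖f t‖ ≤
      ∫ t in Rpos d, (M⁻¹ * (∑ s : Finset (Fin d),
        (∏ l, t l ^ (2 * k l + if l ∈ s then 2 else 0)) * ‖f t‖ ^ 2) +
          M * (∏ l, (1 + t l ^ 2))⁻¹) := by
    refine integral_mono_ae (integrable_monomial_mul_norm hS k) ?_ ?_
    · exact ((integrable_finsetSum _ fun s _ =>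
        integrable_monomial_mul_norm_sq hS _).const_mul _).add
          ((integrable_prod_inv_one_add_sq d).const_mul _)
    · filter_upwards with t
      have hP : 0 < ∏ l, (1 + t l ^ 2) := prod_pos fun l _ => by positivity
      have e : ∑ s : Finset (Fin d), (∏ l, t l ^ (2 * k l + if l ∈ s then 2 else 0)) * ‖f t‖ ^ 2 =
          ((∏ l, t l ^ k l) * ‖f t‖) ^ 2 * ∏ l, (1 + t l ^ 2) := by
        rw [prod_one_add_sq, mul_sum]
        refine sum_congr rfl fun s _ => ?_
        simp only [pow_add, prod_mul_distrib, mul_pow, ← prod_pow]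
        simp only [← pow_mul, mul_comm]
        ring
      rw [e]
      generalize (∏ l, t l ^ k l) * ‖f t‖ = x
      generalize ∏ l, (1 + t l ^ 2) = P at hP
      have e2 : M⁻¹ * (x ^ 2 * P) + M * P⁻¹ - x =
          ((x * P - M / 2) ^ 2 + 3 / 4 * M ^ 2) / (M * P) := by
        field_simp
        ring
      have : 0 ≤ M⁻¹ * (x ^ 2 * P) + M * P⁻¹ - x := by rw [e2]; positivity
      linarith
  rw [integral_add ((integrable_finsetSum _ fun s _ =>
        integrable_monomial_mul_norm_sq hS _).const_mul _)
          ((integrable_prod_inv_one_add_sq d).const_mul _), integral_const_mul, integral_const_mul,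
    integral_finsetSum _ fun s _ => integrable_monomial_mul_norm_sq hS _, ← hJ] at hle
  have hsum : ∑ s : Finset (Fin d),
      ∫ t in Rpos d, (∏ l, t l ^ (2 * k l + if l ∈ s then 2 else 0)) * ‖f t‖ ^ 2 ≤
        N * (C * M) ^ 2 := by
    refine (sum_le_sum fun s _ => hs s).trans_eq ?_
    rw [sum_const, card_univ, nsmul_eq_mul]
  calc ∫ t in Rpos d, (∏ l, t l ^ k l) * ‖f t‖
      ≤ M⁻¹ * (N * (C * M) ^ 2) + M * J := by
        refine hle.trans ?_
        gcongr
    _ = N * C ^ 2 * M + M * J := by field_simp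
    _ = (N * C ^ 2 * E ^ d + J * E ^ d) * m := by rw [hM]; ring
    _ ≤ (N * C ^ 2 * E ^ d + J * E ^ d + 1) * m :=
        mul_le_mul_of_nonneg_right (by linarith) hm0.le

/-- The coefficients of the polynomial dominating `kernelDeriv n`. -/
def kernelMajorant (R : ℝ) (n j : ℕ) : ℝ :=
  R ^ (2 * n) * 3 ^ n * (n.factorial / j.factorial : ℝ)

theorem norm_mul_prod_kernelDeriv_le {d : ℕ} (f : (Fin d → ℝ) → ℂ) (n : Fin d → ℕ)
    {t : Fin d → ℝ} (ht : t ∈ Rpos d) {w : Fin d → ℂ} (hw : ∀ l, ‖w l‖ < 1) {R : ℝ} (hR : 1 ≤ R)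
    (hwR : ∀ l, ‖(1 - w l)⁻¹‖ ≤ R) :
    ‖f t * ∏ l, kernelDeriv (n l) (t l) (w l)‖ ≤
      ∑ κ ∈ Fintype.piFinset fun l => range (n l + 1),
        (∏ l, kernelMajorant R (n l) (κ l)) * ((∏ l, t l ^ κ l) * ‖f t‖) := by
  rw [norm_mul, norm_prod]
  calc ‖f t‖ * ∏ l, ‖kernelDeriv (n l) (t l) (w l)‖
      ≤ ‖f t‖ * ∏ l, ∑ j ∈ range (n l + 1), kernelMajorant R (n l) j * t l ^ j := by
        gcongr with l
        exact norm_kernelDeriv_le (n l) (ht l).le (hw l) hR (hwR l)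
    _ = _ := by
        rw [prod_univ_sum, mul_sum]
        refine sum_congr rfl fun κ _ => ?_
        rw [prod_mul_distrib]
        ring

theorem integrable_kernelMajorant {d : ℕ} {f : (Fin d → ℝ) → ℂ} (hf : IsSPlus f)
    (n : Fin d → ℕ) (R : ℝ) :
    Integrable (fun t => ∑ κ ∈ Fintype.piFinset fun l => range (n l + 1),
        (∏ l, kernelMajorant R (n l) (κ l)) * ((∏ l, t l ^ κ l) * ‖f t‖))
      (volume.restrict (Rpos d)) :=
  integrable_finsetSum _ fun κ _ => (integrable_monomial_mul_norm hf κ).const_mul _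

theorem aestronglyMeasurable_mul_prod_kernelDeriv {d : ℕ} {f : (Fin d → ℝ) → ℂ} (hf : IsSPlus f)
    (n : Fin d → ℕ) (w : Fin d → ℂ) :
    AEStronglyMeasurable (fun t => f t * ∏ l, kernelDeriv (n l) (t l) (w l))
      (volume.restrict (Rpos d)) := by
  refine (aestronglyMeasurable_of_isSPlus hf).mul (Continuous.aestronglyMeasurable ?_)
  exact continuous_finsetProd _ fun l _ =>
    (continuous_kernelDeriv (n l) (w l)).comp (continuous_apply l)

theorem norm_inv_one_sub_le {z : ℂ} {ρ : ℝ} (hρ : ρ < 1) (hz : ‖z‖ ≤ ρ) :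
    ‖(1 - z)⁻¹‖ ≤ (1 - ρ)⁻¹ := by
  rw [norm_inv]
  have h := norm_sub_norm_le (1 : ℂ) z
  rw [norm_one] at h
  exact inv_anti₀ (by linarith) (by linarith)

theorem Dpoly_eq_ball (d : ℕ) : Dpoly d = Metric.ball 0 1 := by
  ext w
  simp [Dpoly, pi_norm_lt_iff]

/-- The formal derivative of `ℱ_D f` of multi-order `n`, taken under the integral sign. -/
def derivFD {d : ℕ} (f : (Fin d → ℝ) → ℂ) (n : Fin d → ℕ) (w : Fin d → ℂ) : ℂ :=
  ∫ t in Rpos d, f t * ∏ l, kernelDeriv (n l) (t l) (w l)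

theorem integrable_mul_prod_kernelDeriv {d : ℕ} {f : (Fin d → ℝ) → ℂ} (hf : IsSPlus f)
    (n : Fin d → ℕ) {w : Fin d → ℂ} (hw : w ∈ Dpoly d) :
    Integrable (fun t => f t * ∏ l, kernelDeriv (n l) (t l) (w l))
      (volume.restrict (Rpos d)) := by
  have hw1 : ‖w‖ < 1 := by simpa [Dpoly_eq_ball] using hw
  refine (integrable_kernelMajorant hf n (1 - ‖w‖)⁻¹).mono'
    (aestronglyMeasurable_mul_prod_kernelDeriv hf n w) ?_
  filter_upwards [ae_mem_Rpos d] with t ht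
  exact norm_mul_prod_kernelDeriv_le f n ht hw
    (one_le_inv₀ (by linarith) |>.2 (by linarith [norm_nonneg w]))
    fun l => norm_inv_one_sub_le hw1 (norm_le_pi_norm w l)

theorem hasFDerivAt_mul_prod_kernelDeriv {d : ℕ} (c : ℂ) (n : Fin d → ℕ) (t : Fin d → ℝ)
    {w : Fin d → ℂ} (hw : w ∈ Dpoly d) :
    HasFDerivAt (fun w : Fin d → ℂ => c * ∏ l, kernelDeriv (n l) (t l) (w l))
      (∑ i, (c * ∏ l, kernelDeriv ((n + Pi.single i 1 : Fin d → ℕ) l) (t l) (w l)) •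
        (ContinuousLinearMap.proj i : (Fin d → ℂ) →L[ℂ] ℂ)) w := by
  have h1 : ∀ l ∈ (univ : Finset (Fin d)),
      HasFDerivAt (fun w : Fin d → ℂ => kernelDeriv (n l) (t l) (w l))
        (kernelDeriv (n l + 1) (t l) (w l) •
          (ContinuousLinearMap.proj l : (Fin d → ℂ) →L[ℂ] ℂ)) w := fun l _ => by
    have hne : 1 - w l ≠ 0 := fun h => by
      have := hw l
      rw [← sub_eq_zero.1 h, norm_one] at this
      exact lt_irrefl _ this
    exact (hasDerivAt_kernelDeriv (n l) (t l) hne).comp_hasFDerivAt w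
      (ContinuousLinearMap.proj l : (Fin d → ℂ) →L[ℂ] ℂ).hasFDerivAt
  refine ((HasFDerivAt.finsetProd h1).const_mul c).congr_fderiv ?_
  rw [smul_sum]
  refine sum_congr rfl fun i _ => ?_
  rw [smul_smul, smul_smul, ← mul_prod_erase univ _ (mem_univ i)]
  congr 1
  have : ∏ l ∈ univ.erase i, kernelDeriv ((n + Pi.single i 1 : Fin d → ℕ) l) (t l) (w l) =
      ∏ l ∈ univ.erase i, kernelDeriv (n l) (t l) (w l) :=
    prod_congr rfl fun l hl => by simp [Pi.single_eq_of_ne (ne_of_mem_erase hl)]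
  rw [this]
  simp
  ring

theorem hasFDerivAt_derivFD {d : ℕ} {f : (Fin d → ℝ) → ℂ} (hf : IsSPlus f) (n : Fin d → ℕ)
    {w : Fin d → ℂ} (hw : w ∈ Dpoly d) :
    HasFDerivAt (derivFD f n) (∑ i, derivFD f (n + Pi.single i 1) w •
      (ContinuousLinearMap.proj i : (Fin d → ℂ) →L[ℂ] ℂ)) w := by
  have hw1 : ‖w‖ < 1 := by simpa [Dpoly_eq_ball] using hw
  obtain ⟨ρ, hwρ, hρ⟩ := exists_between hw1
  have hρ0 : 0 ≤ ρ := (norm_nonneg w).trans hwρ.le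
  have hsub : ∀ z ∈ Metric.ball (0 : Fin d → ℂ) ρ, z ∈ Dpoly d := fun z hz => by
    rw [Dpoly_eq_ball]
    exact Metric.ball_subset_ball hρ.le hz
  let π : Fin d → (Fin d → ℂ) →L[ℂ] ℂ := fun i => ContinuousLinearMap.proj i
  let n' : Fin d → Fin d → ℕ := fun i => n + Pi.single i 1
  let g : Fin d → (Fin d → ℝ) → ℝ := fun i t =>
    ∑ κ ∈ Fintype.piFinset fun l => range (n' i l + 1),
      (∏ l, kernelMajorant (1 - ρ)⁻¹ (n' i l) (κ l)) * ((∏ l, t l ^ κ l) * ‖f t‖)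
  let F' : (Fin d → ℂ) → (Fin d → ℝ) → (Fin d → ℂ) →L[ℂ] ℂ := fun w t =>
    ∑ i, (f t * ∏ l, kernelDeriv (n' i l) (t l) (w l)) • π i
  have hs : Metric.ball (0 : Fin d → ℂ) ρ ∈ nhds w :=
    Metric.isOpen_ball.mem_nhds (by simpa using hwρ)
  have hmeas : AEStronglyMeasurable (F' w) (volume.restrict (Rpos d)) :=
    Finset.aestronglyMeasurable_fun_sum _ fun i _ =>
      (aestronglyMeasurable_mul_prod_kernelDeriv hf (n' i) w).smul_const (π i)
  have hbound : ∀ᵐ t ∂((volume : Measure (Fin d → ℝ)).restrict (Rpos d)),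
      ∀ z ∈ Metric.ball (0 : Fin d → ℂ) ρ, ‖F' z t‖ ≤ ∑ i, g i t * ‖π i‖ := by
    filter_upwards [ae_mem_Rpos d] with t ht z hz
    refine (norm_sum_le _ _).trans (sum_le_sum fun i _ => ?_)
    rw [norm_smul]
    refine mul_le_mul_of_nonneg_right ?_ (norm_nonneg _)
    refine norm_mul_prod_kernelDeriv_le f (n' i) ht (hsub z hz)
      ((one_le_inv₀ (by linarith)).2 (by linarith)) fun l => norm_inv_one_sub_le hρ ?_
    exact (norm_le_pi_norm z l).trans (mem_ball_zero_iff.1 hz).le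
  have hint : Integrable (fun t => ∑ i, g i t * ‖π i‖) (volume.restrict (Rpos d)) :=
    integrable_finsetSum _ fun i _ => (integrable_kernelMajorant hf (n' i) _).mul_const _
  let F : (Fin d → ℂ) → (Fin d → ℝ) → ℂ := fun w t =>
    f t * ∏ l, kernelDeriv (n l) (t l) (w l)
  have hderiv : ∀ᵐ t ∂((volume : Measure (Fin d → ℝ)).restrict (Rpos d)),
      ∀ z ∈ Metric.ball (0 : Fin d → ℂ) ρ, HasFDerivAt (fun z => F z t) (F' z t) z :=
    Eventually.of_forall fun t z hz => hasFDerivAt_mul_prod_kernelDeriv (f t) n t (hsub z hz)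
  have hFmeas : ∀ᶠ z in nhds w, AEStronglyMeasurable (F z) (volume.restrict (Rpos d)) :=
    Eventually.of_forall fun z => aestronglyMeasurable_mul_prod_kernelDeriv hf n z
  have hFint : Integrable (F w) (volume.restrict (Rpos d)) :=
    integrable_mul_prod_kernelDeriv hf n hw
  have key : HasFDerivAt (fun z => ∫ t in Rpos d, F z t) (∫ t in Rpos d, F' w t) w :=
    hasFDerivAt_integral_of_dominated_of_fderiv_le (𝕜 := ℂ) (E := ℂ) (H := Fin d → ℂ)
      hs hFmeas hFint hmeas hbound hint hderiv
  refine key.congr_fderiv ?_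
  have hsmul : ∀ i, Integrable (fun t => (f t * ∏ l, kernelDeriv (n' i l) (t l) (w l)) • π i)
      (volume.restrict (Rpos d)) := fun i =>
    (integrable_mul_prod_kernelDeriv hf (n' i) hw).smul_const (π i)
  refine (integral_finsetSum _ fun i _ => hsmul i).trans (sum_congr rfl fun i _ => ?_)
  exact integral_smul_const _ _

theorem pdC_eqOn_derivFD {d : ℕ} {f : (Fin d → ℝ) → ℂ} (hf : IsSPlus f) {n : Fin d → ℕ}
    {G : (Fin d → ℂ) → ℂ} (hG : Set.EqOn G (derivFD f n) (Dpoly d)) (i : Fin d) :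
    Set.EqOn (pdC i G) (derivFD f (n + Pi.single i 1)) (Dpoly d) := fun w hw => by
  have ho : Dpoly d ∈ nhds w := by
    rw [Dpoly_eq_ball] at hw ⊢
    exact Metric.isOpen_ball.mem_nhds hw
  have hd := (hasFDerivAt_derivFD hf n hw).congr_of_eventuallyEq
    (eventually_of_mem ho hG)
  rw [pdC, hd.fderiv, _root_.sum_apply]
  rw [sum_eq_single i (fun j _ hj => by simp [Pi.single_eq_of_ne hj]) (by simp)]
  simp

theorem iterate_pdC_eqOn_derivFD {d : ℕ} {f : (Fin d → ℝ) → ℂ} (hf : IsSPlus f) {n : Fin d → ℕ}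
    {G : (Fin d → ℂ) → ℂ} (hG : Set.EqOn G (derivFD f n) (Dpoly d)) (i : Fin d) (m : ℕ) :
    Set.EqOn ((pdC i)^[m] G) (derivFD f (n + Pi.single i m)) (Dpoly d) := by
  induction m with
  | zero => simpa using hG
  | succ m ih =>
    rw [Function.iterate_succ_apply', Pi.single_add, ← add_assoc]
    exact pdC_eqOn_derivFD hf ih i

theorem mderivC_FD_eqOn {d : ℕ} {f : (Fin d → ℝ) → ℂ} (hf : IsSPlus f) (p : Fin d → ℕ) :
    Set.EqOn (mderivC p (FD f)) (derivFD f p) (Dpoly d) := by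
  have h0 : Set.EqOn (FD f) (derivFD f 0) (Dpoly d) := fun w _ => by
    simp [FD, derivFD, kernelDeriv_zero]
  have h : ∀ L : List (Fin d), Set.EqOn
      (((L.map fun i => (fun G => (pdC i)^[p i] G)).foldr (· ∘ ·) id) (FD f))
      (derivFD f (L.map fun i => Pi.single i (p i)).sum) (Dpoly d) := fun L => by
    induction L with
    | nil => simpa using h0
    | cons i L ih =>
      rw [List.map_cons, List.map_cons, List.sum_cons, add_comm]
      exact iterate_pdC_eqOn_derivFD hf ih i (p i)
  have hp : ((List.finRange d).map fun i => Pi.single i (p i)).sum = p := by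
    rw [← List.ofFn_eq_map, List.sum_ofFn]
    exact univ_sum_single p
  have := h (List.finRange d)
  rwa [hp, ← List.ofFn_eq_map] at this

theorem sum_kernelMajorant_le {α : ℝ} (hα : 1 ≤ α) {B : ℝ} (hB : 1 ≤ B) (n : ℕ) :
    ∑ j ∈ range (n + 1), kernelMajorant 1 n j * (B ^ j * (j : ℝ) ^ (α * (j : ℝ))) ≤
      (6 * B) ^ n * (n : ℝ) ^ (α * (n : ℝ)) := by
  rcases Nat.eq_zero_or_pos n with rfl | hn
  · simp [kernelMajorant]
  have hn1 : (1:ℝ) ≤ n := by exact_mod_cast hn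
  have hterm : ∀ j ∈ range (n + 1),
      kernelMajorant 1 n j * (B ^ j * (j : ℝ) ^ (α * (j : ℝ))) ≤
        3 ^ n * (B ^ n * (n : ℝ) ^ (α * (n : ℝ))) := fun j hj => by
    have hjn : j ≤ n := by simpa [Nat.lt_succ_iff] using hj
    have hjn' : (j : ℝ) ≤ n := by exact_mod_cast hjn
    have h1 : (n.factorial / j.factorial : ℝ) ≤ (n : ℝ) ^ (α * (n - j : ℝ)) := by
      have e : (n.factorial : ℝ) ≤ (n : ℝ) ^ (n - j) * j.factorial := by
        have e1 := Nat.factorial_mul_descFactorial (n := n) (k := n - j) (by omega)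
        rw [Nat.sub_sub_self hjn] at e1
        have e2 := Nat.descFactorial_le_pow n (n - j)
        have : n.factorial ≤ n ^ (n - j) * j.factorial := by
          rw [← e1, mul_comm]
          exact Nat.mul_le_mul_right _ e2
        exact_mod_cast this
      rw [div_le_iff₀ (by positivity)]
      refine e.trans ?_
      gcongr
      rw [← Real.rpow_natCast, Nat.cast_sub hjn]
      exact Real.rpow_le_rpow_of_exponent_le hn1 (by nlinarith)
    have h2 : (j : ℝ) ^ (α * (j : ℝ)) ≤ (n : ℝ) ^ (α * (j : ℝ)) :=
      Real.rpow_le_rpow (by positivity) hjn' (by positivity)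
    have h3 : B ^ j ≤ B ^ n := pow_le_pow_right₀ hB hjn
    calc kernelMajorant 1 n j * (B ^ j * (j : ℝ) ^ (α * (j : ℝ)))
        = 3 ^ n * (n.factorial / j.factorial : ℝ) * (B ^ j * (j : ℝ) ^ (α * (j : ℝ))) := by
          simp [kernelMajorant]
      _ ≤ 3 ^ n * (n : ℝ) ^ (α * (n - j : ℝ)) * (B ^ n * (n : ℝ) ^ (α * (j : ℝ))) := by gcongr
      _ = 3 ^ n * (B ^ n * ((n : ℝ) ^ (α * (n - j : ℝ)) * (n : ℝ) ^ (α * (j : ℝ)))) := by ring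
      _ = 3 ^ n * (B ^ n * (n : ℝ) ^ (α * (n : ℝ))) := by
          rw [← Real.rpow_add (by linarith)]
          ring_nf
  refine (sum_le_sum hterm).trans ?_
  rw [sum_const, card_range, nsmul_eq_mul]
  have h2 : ((n + 1 : ℕ) : ℝ) ≤ 2 ^ n := by exact_mod_cast (Nat.lt_two_pow_self (n := n))
  calc ((n + 1 : ℕ) : ℝ) * (3 ^ n * (B ^ n * (n : ℝ) ^ (α * (n : ℝ))))
      ≤ 2 ^ n * (3 ^ n * (B ^ n * (n : ℝ) ^ (α * (n : ℝ)))) := by gcongr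
    _ = (6 * B) ^ n * (n : ℝ) ^ (α * (n : ℝ)) := by
      rw [show (6:ℝ) = 2 * 3 by norm_num, mul_pow, mul_pow]; ring

theorem norm_inv_one_sub_le_one {z : ℂ} (hz : z.re ≤ 0) : ‖(1 - z)⁻¹‖ ≤ 1 := by
  rw [norm_inv]
  refine inv_le_one_of_one_le₀ ?_
  have h := Complex.re_le_norm (1 - z)
  simp only [Complex.sub_re, Complex.one_re] at h
  linarith

/-- For `α ≥ 1` and `f ∈ G_α(ℝ^d₊)`: `|D^p ℱ_D(f)(w)| ≤ C A^{|p|} p^{αp}` for all `p` and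
all `w ∈ D` with `Re w_l ≤ 0`. -/
theorem stmt14 {d : ℕ} (α : ℝ) (hα : 1 ≤ α) (f : (Fin d → ℝ) → ℂ) (hf : IsGlow α f) :
    ∃ C > (0:ℝ), ∃ A > (0:ℝ), ∀ p : Fin d → ℕ, ∀ w ∈ Dpoly d, (∀ l, (w l).re ≤ 0) →
      ‖mderivC p (FD f) w‖ ≤
        C * A ^ (∑ l, p l) * ∏ l, ((p l : ℝ)) ^ (α * (p l : ℝ)) := by
  obtain ⟨C, hC, B, hB, h⟩ := exists_moment_bound hα hf
  refine ⟨C, hC, 6 * B, by positivity, fun p w hw hre => ?_⟩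
  have hS := hf.1
  have hK : ∀ n j : ℕ, 0 ≤ kernelMajorant 1 n j := fun n j => by
    unfold kernelMajorant
    positivity
  rw [mderivC_FD_eqOn hS p hw, derivFD]
  calc ‖∫ t in Rpos d, f t * ∏ l, kernelDeriv (p l) (t l) (w l)‖
      ≤ ∫ t in Rpos d, ∑ κ ∈ Fintype.piFinset fun l => range (p l + 1),
        (∏ l, kernelMajorant 1 (p l) (κ l)) * ((∏ l, t l ^ κ l) * ‖f t‖) := by
        refine norm_integral_le_of_norm_le (integrable_kernelMajorant hS p 1) ?_
        filter_upwards [ae_mem_Rpos d] with t ht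
        exact norm_mul_prod_kernelDeriv_le f p ht hw le_rfl
          fun l => norm_inv_one_sub_le_one (hre l)
    _ = ∑ κ ∈ Fintype.piFinset fun l => range (p l + 1),
        (∏ l, kernelMajorant 1 (p l) (κ l)) * ∫ t in Rpos d, (∏ l, t l ^ κ l) * ‖f t‖ := by
        rw [integral_finsetSum _ fun κ _ => (integrable_monomial_mul_norm hS κ).const_mul _]
        exact sum_congr rfl fun κ _ => integral_const_mul _ _
    _ ≤ ∑ κ ∈ Fintype.piFinset fun l => range (p l + 1),
        (∏ l, kernelMajorant 1 (p l) (κ l)) *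
          (C * ∏ l, (B ^ κ l * (κ l : ℝ) ^ (α * (κ l : ℝ)))) := by
        refine sum_le_sum fun κ _ => mul_le_mul_of_nonneg_left (h κ) ?_
        exact prod_nonneg fun l _ => hK _ _
    _ = C * ∏ l, ∑ j ∈ range (p l + 1),
        kernelMajorant 1 (p l) j * (B ^ j * (j : ℝ) ^ (α * (j : ℝ))) := by
        rw [prod_univ_sum, mul_sum]
        refine sum_congr rfl fun κ _ => ?_
        simp only [prod_mul_distrib]
        ring
    _ ≤ C * ∏ l, ((6 * B) ^ p l * (p l : ℝ) ^ (α * (p l : ℝ))) := by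
        refine mul_le_mul_of_nonneg_left (prod_le_prod (fun l _ => ?_) fun l _ =>
          sum_kernelMajorant_le hα hB (p l)) hC.le
        exact sum_nonneg fun j _ => mul_nonneg (hK _ _) (by positivity)
    _ = C * (6 * B) ^ (∑ l, p l) * ∏ l, ((p l : ℝ)) ^ (α * (p l : ℝ)) := by
        rw [prod_mul_distrib, prod_pow_eq_pow_sum, mul_assoc]
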